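/- Let z be an irrational real number, with complete quotients z_{j+1} of the negative regular continued fraction expansion of z and ⌈ ⌉-convergents s_j/t_j. For every j ≥ 1, the fraction s_j/t_j is a ⌊ ⌋-convergent of z if and only if z_{j+1} > 2. -/

import Mathlib

open Filter Finset

/-- Complete quotients of the regular continued fraction: `rX z n` is `z_n`,
with `z_0 = z` and `z_{n+1} = 1/(z_n - ⌊z_n⌋)`. -/
noncomputable def rXaux : ℕ → ℝ → ℝ
  | 0, z => z
  | n + 1, z => rXaux n (1 / (z - ⌊z⌋))

noncomputable def rX (z : ℝ) (n : ℕ) : ℝ := rXaux n z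

/-- Partial quotients of the regular continued fraction: `rA z n` is `a_n = ⌊z_n⌋`. -/
noncomputable def rA (z : ℝ) (n : ℕ) : ℤ := ⌊rX z n⌋

/-- Numerators of the regular (⌊ ⌋-)convergents, with shifted index:
`rP z 0 = p_{-1} = 1` and `rP z (k+1) = p_k`. -/
noncomputable def rP (z : ℝ) : ℕ → ℤ
  | 0 => 1
  | 1 => rA z 0
  | n + 2 => rA z (n + 1) * rP z (n + 1) + rP z n

/-- Denominators of the regular (⌊ ⌋-)convergents, with shifted index:
`rQ z 0 = q_{-1} = 0` and `rQ z (k+1) = q_k`. -/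
noncomputable def rQ (z : ℝ) : ℕ → ℤ
  | 0 => 0
  | 1 => 1
  | n + 2 => rA z (n + 1) * rQ z (n + 1) + rQ z n

/-- Complete quotients of the negative regular continued fraction: `nX z n` is `z_n`,
with `z_0 = z` and `z_{n+1} = 1/(⌈z_n⌉ - z_n)`. -/
noncomputable def nXaux : ℕ → ℝ → ℝ
  | 0, z => z
  | n + 1, z => nXaux n (1 / (⌈z⌉ - z))

noncomputable def nX (z : ℝ) (n : ℕ) : ℝ := nXaux n z

/-- Partial quotients of the negative regular continued fraction: `nC z n` is `c_n = ⌈z_n⌉`. -/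
noncomputable def nC (z : ℝ) (n : ℕ) : ℤ := ⌈nX z n⌉

/-- Numerators of the negative regular (⌈ ⌉-)convergents, with shifted index:
`nS z 0 = s_{-1} = 1` and `nS z (j+1) = s_j`. -/
noncomputable def nS (z : ℝ) : ℕ → ℤ
  | 0 => 1
  | 1 => nC z 0
  | n + 2 => nC z (n + 1) * nS z (n + 1) - nS z n

/-- Denominators of the negative regular (⌈ ⌉-)convergents, with shifted index:
`nT z 0 = t_{-1} = 0` and `nT z (j+1) = t_j`. -/
noncomputable def nT (z : ℝ) : ℕ → ℤ
  | 0 => 0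
  | 1 => 1
  | n + 2 => nC z (n + 1) * nT z (n + 1) - nT z n

/-- If `z` lies between `P / Q` and `P' / Q'`, where the pairs `(P, Q)` and `(P', Q')` span `ℤ²`, then
a pair `(r, u)` with `0 < u < Q + Q'` is a multiple of `(P, Q)` or approximates `z` no better than
`(P', Q')` does. -/
lemma eq_mul_or_abs_sub_le {z : ℝ} {P Q P' Q' r u e : ℤ} (he : e * e = 1)
    (hdet : P * Q' - P' * Q = e) (hQ : 0 ≤ Q) (hQ' : 0 ≤ Q')
    (hsign : (Q * z - P) * (Q' * z - P') ≤ 0) (hu : 0 < u) (hu' : u < Q + Q') :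
    (∃ a : ℤ, r = a * P ∧ u = a * Q) ∨ |Q' * z - P'| ≤ |u * z - r| := by
  obtain ⟨a, b, hr, hub⟩ : ∃ a b : ℤ, r = a * P + b * P' ∧ u = a * Q + b * Q' := by
    refine ⟨e * (r * Q' - P' * u), e * (P * u - r * Q), ?_, ?_⟩
    · linear_combination (-r) * he - e * r * hdet
    · linear_combination (-u) * he - e * u * hdet
  have hval : (u * z - r : ℝ) = a * (Q * z - P) + b * (Q' * z - P') := by
    rw [hr, hub]; push_cast; ring
  rcases eq_or_ne b 0 with hb | hb
  · exact Or.inl ⟨a, by simpa [hb] using hr, by simpa [hb] using hub⟩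
  right
  have hab : a * b ≤ 0 := by
    by_contra! h
    rcases pos_and_pos_or_neg_and_neg_of_mul_pos h with ⟨ha, hb⟩ | ⟨ha, hb⟩ <;> nlinarith
  have hab' : (a * b : ℝ) ≤ 0 := mod_cast hab
  have hb2 : (1 : ℝ) ≤ b ^ 2 := by
    have : 1 ≤ b ^ 2 := by have := sq_pos_of_ne_zero hb; omega
    exact_mod_cast this
  rw [hval, ← sq_le_sq]
  nlinarith [mul_nonneg_of_nonpos_of_nonpos hab' hsign,
    mul_nonneg (sub_nonneg.2 hb2) (sq_nonneg (Q' * z - P')), sq_nonneg (a * (Q * z - P))]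

section Regular

lemma rX_succ (z : ℝ) (n : ℕ) : rX z (n + 1) = 1 / (rX z n - ⌊rX z n⌋) := by
  unfold rX
  induction n generalizing z with
  | zero => rfl
  | succ n ih => exact ih _

variable {z : ℝ}

lemma irrational_rX (hz : Irrational z) (n : ℕ) : Irrational (rX z n) := by
  induction n with
  | zero => exact hz
  | succ n ih =>
    rw [rX_succ, one_div]
    exact (ih.sub_intCast _).inv

lemma one_lt_rX_succ (hz : Irrational z) (n : ℕ) : 1 < rX z (n + 1) := by
  have h := (irrational_rX hz n).sub_intCast ⌊rX z n⌋
  rw [rX_succ, one_div]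
  exact one_lt_inv_iff₀.2
    ⟨lt_of_le_of_ne (Int.fract_nonneg _) h.ne_zero.symm, Int.fract_lt_one _⟩

lemma one_le_rA_succ (hz : Irrational z) (n : ℕ) : 1 ≤ rA z (n + 1) :=
  Int.le_floor.2 (by simpa using (one_lt_rX_succ hz n).le)

lemma rQ_mul_sub_rP (hz : Irrational z) (n : ℕ) :
    rQ z n * z - rP z n = -rX z (n + 1) * (rQ z (n + 1) * z - rP z (n + 1)) := by
  induction n with
  | zero =>
    have h := (irrational_rX hz 0).sub_intCast ⌊rX z 0⌋
    rw [rX_succ]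
    have h0 : (rX z 0 - ⌊rX z 0⌋) ≠ 0 := h.ne_zero
    have e : rX z 0 = z := rfl
    simp only [rQ, rP, rA]
    field_simp
    simp [e]
  | succ n ih =>
    have h0 := ((irrational_rX hz (n + 1)).sub_intCast ⌊rX z (n + 1)⌋).ne_zero
    have hx : rX z (n + 2) * (rX z (n + 1) - rA z (n + 1)) = 1 := by
      rw [rX_succ z (n + 1), rA]; field_simp
    simp only [rQ, rP] at ih ⊢
    push_cast
    linear_combination (-(rQ z (n + 1) * z - rP z (n + 1))) * hx + rX z (n + 2) * ih

lemma rP_mul_rQ_sub (z : ℝ) (n : ℕ) :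
    rP z (n + 1) * rQ z n - rP z n * rQ z (n + 1) = (-1) ^ (n + 1) := by
  induction n with
  | zero => simp [rP, rQ]
  | succ n ih =>
    simp only [rQ, rP] at ih ⊢
    rw [pow_succ]
    linear_combination -ih

lemma rQ_nonneg_and_pos (hz : Irrational z) (n : ℕ) : 0 ≤ rQ z n ∧ 0 < rQ z (n + 1) := by
  induction n with
  | zero => simp [rQ]
  | succ n ih =>
    refine ⟨ih.2.le, ?_⟩
    have := one_le_rA_succ hz n
    simp only [rQ]
    nlinarith

lemma le_rQ_succ (hz : Irrational z) (n : ℕ) : (n : ℤ) ≤ rQ z (n + 1) := by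
  induction n using Nat.strong_induction_on with
  | _ n ih =>
    match n with
    | 0 => simp [rQ]
    | 1 => exact (rQ_nonneg_and_pos hz 1).2
    | n + 2 =>
      have h1 := ih (n + 1) (by omega)
      have h2 := (rQ_nonneg_and_pos hz n).2
      have h3 := one_le_rA_succ hz (n + 1)
      rw [rQ]
      push_cast at h1 ⊢
      nlinarith

lemma rQ_mul_sub_rP_ne_zero (hz : Irrational z) (n : ℕ) :
    (rQ z (n + 1) * z - rP z (n + 1) : ℝ) ≠ 0 :=
  ((hz.intCast_mul (rQ_nonneg_and_pos hz n).2.ne').sub_intCast _).ne_zero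

lemma rQ_mul_sub_rP_mul_nonpos (hz : Irrational z) (n : ℕ) :
    (rQ z (n + 1) * z - rP z (n + 1)) * (rQ z n * z - rP z n) ≤ 0 := by
  rw [rQ_mul_sub_rP hz n]
  nlinarith [one_lt_rX_succ hz n, mul_nonneg (zero_lt_one.trans (one_lt_rX_succ hz n)).le
    (sq_nonneg (rQ z (n + 1) * z - rP z (n + 1)))]

lemma isCoprime_rP_rQ (z : ℝ) (n : ℕ) : IsCoprime (rP z (n + 1)) (rQ z (n + 1)) := by
  have h := rP_mul_rQ_sub z n
  have he : ((-1 : ℤ) ^ (n + 1)) * (-1) ^ (n + 1) = 1 := by rw [← mul_pow]; simp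
  exact ⟨(-1) ^ (n + 1) * rQ z n, -(-1) ^ (n + 1) * rP z n,
    by linear_combination (-1) ^ (n + 1) * h + he⟩

lemma exists_rQ_le_lt (hz : Irrational z) {T : ℤ} (hT : 0 < T) :
    ∃ k, rQ z (k + 1) ≤ T ∧ T < rQ z (k + 2) := by
  classical
  have hex : ∃ m, T < rQ z (m + 1) :=
    ⟨T.toNat + 1, by have := le_rQ_succ hz (T.toNat + 1); push_cast at this; omega⟩
  obtain ⟨k, hk⟩ : ∃ k, Nat.find hex = k + 1 := by
    refine Nat.exists_eq_succ_of_ne_zero fun h => ?_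
    have := Nat.find_spec hex
    rw [h] at this
    simp only [rQ] at this
    omega
  refine ⟨k, not_lt.1 (Nat.find_min hex (by omega)), ?_⟩
  have := Nat.find_spec hex
  rwa [hk] at this

/-- A fraction whose denominator is smaller than that of the next convergent does not approximate
`z` better than the current convergent. -/
lemma abs_rQ_mul_sub_rP_le (hz : Irrational z) {k : ℕ} {r u : ℤ} (hu : 0 < u)
    (huk : u < rQ z (k + 1)) : |rQ z k * z - rP z k| ≤ |u * z - r| := by
  have hQ := (rQ_nonneg_and_pos hz k).1
  refine (eq_mul_or_abs_sub_le (by rw [← mul_pow]; simp) (rP_mul_rQ_sub z k) (by omega) hQ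
    (rQ_mul_sub_rP_mul_nonpos hz k) hu (by omega)).resolve_left ?_
  rintro ⟨a, -, rfl⟩
  have ha : 0 < a := pos_of_mul_pos_left hu (by omega)
  nlinarith

end Regular

section Negative

lemma nX_succ (z : ℝ) (n : ℕ) : nX z (n + 1) = 1 / (⌈nX z n⌉ - nX z n) := by
  unfold nX
  induction n generalizing z with
  | zero => rfl
  | succ n ih => exact ih _

variable {z : ℝ}

lemma irrational_nX (hz : Irrational z) (n : ℕ) : Irrational (nX z n) := by
  induction n with
  | zero => exact hz
  | succ n ih =>
    rw [nX_succ, one_div]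
    exact (ih.intCast_sub _).inv

lemma one_lt_nX_succ (hz : Irrational z) (n : ℕ) : 1 < nX z (n + 1) := by
  have h := ((irrational_nX hz n).intCast_sub ⌈nX z n⌉).ne_zero
  rw [nX_succ, one_div]
  refine one_lt_inv_iff₀.2 ⟨lt_of_le_of_ne (sub_nonneg.2 (Int.le_ceil _)) h.symm, ?_⟩
  linarith [Int.ceil_lt_add_one (nX z n)]

lemma two_le_nC_succ (hz : Irrational z) (n : ℕ) : 2 ≤ nC z (n + 1) := by
  have : (1 : ℤ) < ⌈nX z (n + 1)⌉ := Int.lt_ceil.2 (by simpa using one_lt_nX_succ hz n)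
  exact this

lemma nT_mul_sub_nS (hz : Irrational z) (n : ℕ) :
    nT z n * z - nS z n = nX z (n + 1) * (nT z (n + 1) * z - nS z (n + 1)) := by
  induction n with
  | zero =>
    have h0 := ((irrational_nX hz 0).intCast_sub ⌈nX z 0⌉).ne_zero
    have e : nX z 0 = z := rfl
    rw [nX_succ]
    simp only [nT, nS, nC]
    field_simp
    simp [e]
  | succ n ih =>
    have h0 := ((irrational_nX hz (n + 1)).intCast_sub ⌈nX z (n + 1)⌉).ne_zero
    have hx : nX z (n + 2) * (nC z (n + 1) - nX z (n + 1)) = 1 := by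
      rw [nX_succ z (n + 1), nC]; field_simp
    simp only [nT, nS] at ih ⊢
    push_cast
    linear_combination (-(nT z (n + 1) * z - nS z (n + 1))) * hx + nX z (n + 2) * ih

lemma nS_mul_nT_sub (z : ℝ) (n : ℕ) :
    nS z n * nT z (n + 1) - nS z (n + 1) * nT z n = 1 := by
  induction n with
  | zero => simp [nS, nT]
  | succ n ih =>
    simp only [nS, nT] at ih ⊢
    linear_combination ih

lemma nT_nonneg_and_lt (hz : Irrational z) (n : ℕ) : 0 ≤ nT z n ∧ nT z n < nT z (n + 1) := by
  induction n with
  | zero => simp [nT]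
  | succ n ih =>
    refine ⟨ih.1.trans ih.2.le, ?_⟩
    have := two_le_nC_succ hz n
    simp only [nT]
    nlinarith

lemma isCoprime_nS_nT (z : ℝ) (n : ℕ) : IsCoprime (nS z (n + 1)) (nT z (n + 1)) :=
  ⟨-nT z n, nS z n, by linear_combination nS_mul_nT_sub z n⟩

/-- The error of the mediant-type pair `(s_j - s_{j-1}, t_j - t_{j-1})` in terms of that of
`(s_j, t_j)`. -/
lemma nT_sub_mul_sub_nS_sub (hz : Irrational z) (n : ℕ) :
    ((nT z (n + 1) - nT z n : ℤ) * z - (nS z (n + 1) - nS z n : ℤ) : ℝ) =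
      -(nX z (n + 1) - 1) * (nT z (n + 1) * z - nS z (n + 1)) := by
  push_cast
  linear_combination -nT_mul_sub_nS hz n

lemma abs_nT_sub_mul_sub_nS_sub (hz : Irrational z) (n : ℕ) :
    |((nT z (n + 1) - nT z n : ℤ) * z - (nS z (n + 1) - nS z n : ℤ) : ℝ)| =
      (nX z (n + 1) - 1) * |nT z (n + 1) * z - nS z (n + 1)| := by
  rw [nT_sub_mul_sub_nS_sub hz, abs_mul, abs_neg,
    abs_of_pos (sub_pos.2 (one_lt_nX_succ hz n))]

lemma nT_mul_sub_nS_ne_zero (hz : Irrational z) (n : ℕ) :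
    (nT z (n + 1) * z - nS z (n + 1) : ℝ) ≠ 0 := by
  have h := nT_nonneg_and_lt hz n
  exact ((hz.intCast_mul (by omega)).sub_intCast _).ne_zero

end Negative

/-- For irrational `z` and `j ≥ 1`, the ⌈ ⌉-convergent `s_j/t_j` is a
⌊ ⌋-convergent of `z` iff the complete quotient `z_{j+1}` of the negative regular
expansion satisfies `z_{j+1} > 2`. -/
theorem stmt2 (z : ℝ) (hz : Irrational z) (j : ℕ) (hj : 1 ≤ j) :
    (∃ k : ℕ, (nS z (j + 1) : ℝ) / (nT z (j + 1) : ℝ) = (rP z (k + 1) : ℝ) / (rQ z (k + 1) : ℝ))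
      ↔ 2 < nX z (j + 1) := by
  obtain ⟨ht0, ht⟩ := nT_nonneg_and_lt hz j
  have htj : 0 < nT z j := by
    obtain ⟨i, rfl⟩ := Nat.exists_eq_add_of_le' hj
    have := nT_nonneg_and_lt hz i
    omega
  have hmed := abs_nT_sub_mul_sub_nS_sub hz j
  have hpos : 0 < |(nT z (j + 1) * z - nS z (j + 1) : ℝ)| :=
    abs_pos.2 (nT_mul_sub_nS_ne_zero hz j)
  constructor
  · rintro ⟨k, hk⟩
    by_contra! hx
    have hq := (rQ_nonneg_and_pos hz k).2
    obtain ⟨hs, htq⟩ := Rat.div_int_inj (ht0.trans_lt ht) hq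
      (Int.isCoprime_iff_nat_coprime.1 (isCoprime_nS_nT z j))
      (Int.isCoprime_iff_nat_coprime.1 (isCoprime_rP_rQ z k)) (by exact_mod_cast hk)
    have h := abs_rQ_mul_sub_rP_le hz (k := k) (r := nS z (j + 1) - nS z j)
      (u := nT z (j + 1) - nT z j) (by omega) (by omega)
    have hy := one_lt_rX_succ hz k
    rw [hmed, rQ_mul_sub_rP hz k, abs_mul, abs_neg, abs_of_pos (by linarith), ← hs, ← htq] at h
    nlinarith
  · intro hx
    obtain ⟨k, hk, hk'⟩ := exists_rQ_le_lt hz (ht0.trans_lt ht)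
    have h1 := abs_rQ_mul_sub_rP_le hz (r := nS z (j + 1)) (ht0.trans_lt ht) hk'
    have hq := (rQ_nonneg_and_pos hz k).2
    rcases eq_mul_or_abs_sub_le (z := z) (P := nS z (j + 1)) (Q := nT z (j + 1))
      (P' := nS z (j + 1) - nS z j) (Q' := nT z (j + 1) - nT z j) (r := rP z (k + 1))
      (u := rQ z (k + 1)) (e := 1) (by norm_num) (by linear_combination nS_mul_nT_sub z j)
      (by omega) (by omega)
      (by
        rw [nT_sub_mul_sub_nS_sub hz]
        nlinarith [mul_nonneg (sub_nonneg.2 (one_lt_nX_succ hz j).le)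
          (sq_nonneg (nT z (j + 1) * z - nS z (j + 1)))])
      hq (by omega) with ⟨a, hP, hQ⟩ | h2
    · refine ⟨k, ?_⟩
      have ha : (a : ℝ) ≠ 0 := by
        rintro h
        rw [Int.cast_eq_zero.1 h] at hQ
        omega
      rw [hP, hQ]
      push_cast
      rw [mul_div_mul_left _ _ ha]
    · rw [hmed] at h2
      nlinarith
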